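/- There exist a set S ⊆ ℤ and a constant K > 0 such that S satisfies the Λ(4) inequality with constant K, and for every real δ > 0 and every positive integer g, there exists a nonempty finite subset A ⊆ S such that no subset A' ⊆ A with |A'| ≥ δ·|A| is a B₂[g] set or a B₂°[g] set. -/

import Mathlib

/-- `S ⊆ G` is a `B₂[g]` set: every element has at most `g` representations as a sum
`a + b` with `a, b ∈ S`, counting representations differing only in order as one. -/
def IsB2 {G : Type} [AddCommGroup G] (g : ℕ) (S : Set G) : Prop :=
  ∀ ξ : G, {p : Sym2 G | ∃ a ∈ S, ∃ b ∈ S, p = s(a, b) ∧ a + b = ξ}.encard ≤ g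

/-- `S ⊆ G` is a `B₂°[g]` set: every nonzero element has at most `g` representations
as a difference `a - b` with `a, b ∈ S`. -/
def IsB2Circ {G : Type} [AddCommGroup G] (g : ℕ) (S : Set G) : Prop :=
  ∀ ξ : G, ξ ≠ 0 → {p : G × G | p.1 ∈ S ∧ p.2 ∈ S ∧ p.1 - p.2 = ξ}.encard ≤ g

/-- `S ⊆ ℤ` satisfies the `Λ(4)` inequality with constant `K`. -/
def SatisfiesLambda4 (S : Set ℤ) (K : ℝ) : Prop :=
  ∀ f : ℤ →₀ ℂ, (↑f.support : Set ℤ) ⊆ S →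
    MeasureTheory.eLpNorm
      (fun x : AddCircle (1 : ℝ) => ∑ ξ ∈ f.support, f ξ * fourier ξ x) 4
      AddCircle.haarAddCircle
      ≤ ENNReal.ofReal (K * Real.sqrt (∑ ξ ∈ f.support, ‖f ξ‖ ^ 2))


theorem e2_bound (T : Finset ℤ) (g : ℤ → ℝ)
    (h : ∀ a ∈ T, ∀ b ∈ T, ((T ×ˢ T).filter (fun y => a + b = y.1 + y.2)).card ≤ 4) :
    ∑ x ∈ T ×ˢ T, ∑ y ∈ T ×ˢ T,
      (if x.1 + x.2 = y.1 + y.2 then g x.1 * g x.2 * (g y.1 * g y.2) else 0)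
      ≤ 4 * (∑ a ∈ T, g a ^ 2) ^ 2 := by
  have key : ∀ x ∈ T ×ˢ T, ∑ y ∈ T ×ˢ T, (if x.1 + x.2 = y.1 + y.2 then
      (g x.1 * g x.2) ^ 2 else 0) ≤ 4 * (g x.1 * g x.2) ^ 2 := by
    intro x hx
    rw [Finset.mem_product] at hx
    rw [← Finset.sum_filter, Finset.sum_const, nsmul_eq_mul]
    have := h x.1 hx.1 x.2 hx.2
    have h' : (((T ×ˢ T).filter (fun y => x.1 + x.2 = y.1 + y.2)).card : ℝ) ≤ 4 := by
      exact_mod_cast this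
    exact mul_le_mul_of_nonneg_right h' (sq_nonneg _)
  have hs : ∑ x ∈ T ×ˢ T, (g x.1 * g x.2) ^ 2 = (∑ a ∈ T, g a ^ 2) ^ 2 := by
    rw [sq (∑ a ∈ T, g a ^ 2), Finset.sum_mul_sum, Finset.sum_product]
    simp only [mul_pow]
  have h1 : ∑ x ∈ T ×ˢ T, ∑ y ∈ T ×ˢ T, (if x.1 + x.2 = y.1 + y.2 then
      (g x.1 * g x.2) ^ 2 else 0) ≤ 4 * (∑ a ∈ T, g a ^ 2) ^ 2 := by
    rw [← hs, Finset.mul_sum]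
    exact Finset.sum_le_sum key
  have h2 : ∑ x ∈ T ×ˢ T, ∑ y ∈ T ×ˢ T, (if x.1 + x.2 = y.1 + y.2 then
      (g y.1 * g y.2) ^ 2 else 0) ≤ 4 * (∑ a ∈ T, g a ^ 2) ^ 2 := by
    rw [Finset.sum_comm]
    refine le_trans (le_of_eq ?_) h1
    refine Finset.sum_congr rfl fun x _ => Finset.sum_congr rfl fun y _ => ?_
    simp only [eq_comm]
  have h3 : ∑ x ∈ T ×ˢ T, ∑ y ∈ T ×ˢ T,
      (if x.1 + x.2 = y.1 + y.2 then g x.1 * g x.2 * (g y.1 * g y.2) else 0)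
      ≤ (∑ x ∈ T ×ˢ T, ∑ y ∈ T ×ˢ T, (if x.1 + x.2 = y.1 + y.2 then
      (g x.1 * g x.2) ^ 2 else 0)) / 2 + (∑ x ∈ T ×ˢ T, ∑ y ∈ T ×ˢ T,
      (if x.1 + x.2 = y.1 + y.2 then (g y.1 * g y.2) ^ 2 else 0)) / 2 := by
    rw [Finset.sum_div, Finset.sum_div, ← Finset.sum_add_distrib]
    refine Finset.sum_le_sum fun x _ => ?_
    rw [Finset.sum_div, Finset.sum_div, ← Finset.sum_add_distrib]
    refine Finset.sum_le_sum fun y _ => ?_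
    split_ifs
    · nlinarith [sq_nonneg (g x.1 * g x.2 - g y.1 * g y.2)]
    · simp
  linarith

theorem fiber_sq {α : Type*} (P : Finset α) (π : α → ℤ) (D : Finset ℤ)
    (hD : ∀ x ∈ P, π x ∈ D) (h : α → ℝ) :
    ∑ d ∈ D, (∑ x ∈ P, if π x = d then h x else 0) ^ 2
      = ∑ x ∈ P, ∑ y ∈ P, if π x = π y then h x * h y else 0 := by
  simp_rw [sq, Finset.sum_mul_sum]
  rw [Finset.sum_comm]
  refine Finset.sum_congr rfl fun x hx => ?_
  rw [Finset.sum_comm]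
  refine Finset.sum_congr rfl fun y hy => ?_
  rw [Finset.sum_eq_single (π x)]
  · by_cases hxy : π x = π y <;> simp [hxy, eq_comm]
  · intro d _ hd
    simp [Ne.symm hd]
  · intro hn
    exact absurd (hD x hx) hn

open Classical in
theorem energy_bound {K : Type} (T : Finset ℤ) (col : ℤ → K) (g : ℤ → ℝ) (hg : ∀ a, 0 ≤ g a)
    (H1 : ∀ a ∈ T, ∀ b ∈ T, ∀ c ∈ T, ∀ d ∈ T, a + b = c + d →
      (col a = col c ∧ col b = col d) ∨ (col a = col d ∧ col b = col c))
    (H2 : ∀ a ∈ T, ∀ b ∈ T, col a = col b →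
      ((T ×ˢ T).filter (fun y => col y.1 = col a ∧ col y.2 = col a ∧ a + b = y.1 + y.2)).card ≤ 4) :
    ∑ a ∈ T, ∑ b ∈ T, ∑ c ∈ T, ∑ d ∈ T,
      (if a + b = c + d then g a * g b * (g c * g d) else 0) ≤ 8 * (∑ a ∈ T, g a ^ 2) ^ 2 := by
  set I : ℝ := ∑ a ∈ T, ∑ b ∈ T, ∑ c ∈ T, ∑ d ∈ T,
      (if a + b = c + d ∧ col a = col c ∧ col b = col d then g a * g b * (g c * g d) else 0) with hI
  -- step 1
  have s1 : ∑ a ∈ T, ∑ b ∈ T, ∑ c ∈ T, ∑ d ∈ T,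
      (if a + b = c + d then g a * g b * (g c * g d) else 0) ≤ I + I := by
    have hI2 : I = ∑ a ∈ T, ∑ b ∈ T, ∑ c ∈ T, ∑ d ∈ T,
      (if a + b = c + d ∧ col a = col d ∧ col b = col c then g a * g b * (g c * g d) else 0) := by
      rw [hI]
      refine Finset.sum_congr rfl fun a _ => Finset.sum_congr rfl fun b _ => ?_
      rw [Finset.sum_comm]
      refine Finset.sum_congr rfl fun c _ => Finset.sum_congr rfl fun d _ => ?_
      rw [add_comm d c, mul_comm (g d) (g c)]
    nth_rewrite 2 [hI2]
    rw [hI]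
    simp only [← Finset.sum_add_distrib]
    refine Finset.sum_le_sum fun a ha => Finset.sum_le_sum fun b hb =>
      Finset.sum_le_sum fun c hc => Finset.sum_le_sum fun d hd => ?_
    have hnn : 0 ≤ g a * g b * (g c * g d) :=
      mul_nonneg (mul_nonneg (hg a) (hg b)) (mul_nonneg (hg c) (hg d))
    by_cases h : a + b = c + d
    · rcases H1 a ha b hb c hc d hd h with h' | h'
      · rw [if_pos h, if_pos ⟨h, h'⟩]
        have : 0 ≤ (if a + b = c + d ∧ col a = col d ∧ col b = col c then
          g a * g b * (g c * g d) else 0) := by split_ifs <;> simp [hnn]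
        linarith
      · rw [if_pos h, if_pos (c := a + b = c + d ∧ col a = col d ∧ col b = col c) ⟨h, h'⟩]
        have : 0 ≤ (if a + b = c + d ∧ col a = col c ∧ col b = col d then
          g a * g b * (g c * g d) else 0) := by split_ifs <;> simp [hnn]
        linarith
    · simp [h]
  -- step 2
  set D : Finset ℤ := (T ×ˢ T).image (fun x => x.1 - x.2) with hD
  have hDm : ∀ x ∈ T ×ˢ T, x.1 - x.2 ∈ D := fun x hx => Finset.mem_image_of_mem _ hx
  set P := (T ×ˢ T).filter (fun x => col x.1 = col x.2) with hP
  set Tp : K → Finset ℤ := fun p => T.filter (fun a => col a = p) with hTp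
  set V : D → ℝ := fun d => ∑ x ∈ P, if x.1 - x.2 = (d : ℤ) then g x.1 * g x.2 else 0 with hV
  set W : K → EuclideanSpace ℝ D := fun p => WithLp.toLp 2 (fun d : D =>
    ∑ x ∈ Tp p ×ˢ Tp p, if x.1 - x.2 = (d : ℤ) then g x.1 * g x.2 else 0) with hW
  have hVW : WithLp.toLp 2 V = ∑ p ∈ T.image col, W p := by
    ext d
    simp only [WithLp.ofLp_sum, Finset.sum_apply, hV, hW]
    rw [← Finset.sum_fiberwise_of_maps_to (s := P) (t := T.image col) (g := fun x => col x.1)]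
    · refine Finset.sum_congr rfl fun p _ => Finset.sum_congr ?_ fun _ _ => rfl
      ext x
      simp only [hP, hTp, Finset.mem_filter, Finset.mem_product]
      constructor
      · rintro ⟨⟨⟨h1, h2⟩, h3⟩, h4⟩
        exact ⟨⟨h1, h4⟩, h2, h3 ▸ h4⟩
      · rintro ⟨⟨h1, h4⟩, h2, h3⟩
        exact ⟨⟨⟨h1, h2⟩, h4.trans h3.symm⟩, h4⟩
    · intro x hx
      simp only [hP, Finset.mem_filter, Finset.mem_product] at hx
      exact Finset.mem_image_of_mem _ hx.1.1
  have hIV : I = ‖(WithLp.toLp 2 V : EuclideanSpace ℝ D)‖ ^ 2 := by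
    rw [EuclideanSpace.norm_sq_eq]
    simp only [Real.norm_eq_abs, sq_abs, hV]
    rw [Finset.sum_coe_sort D (fun d => (∑ x ∈ P, if x.1 - x.2 = d then g x.1 * g x.2 else 0) ^ 2)]
    rw [fiber_sq P (fun x => x.1 - x.2) D (fun x hx => hDm x (Finset.mem_filter.1 hx).1)
      (fun x => g x.1 * g x.2)]
    rw [hI, hP, Finset.sum_filter, Finset.sum_product]
    refine Finset.sum_congr rfl fun a _ => ?_
    rw [Finset.sum_comm]
    refine Finset.sum_congr rfl fun c _ => ?_
    rw [Finset.sum_filter, Finset.sum_product]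
    split_ifs with hac
    · rw [Finset.sum_comm]
      refine Finset.sum_congr rfl fun d _ => Finset.sum_congr rfl fun b _ => ?_
      by_cases hb : col b = col d
      · have : (a + b = c + d) ↔ (a - c = d - b) := by constructor <;> intro h <;> omega
        simp only [hac, hb, this, and_true, if_true]
        split_ifs <;> ring
      · simp [hb, Ne.symm hb]
    · simp [hac]
  have hWn : ∀ p, ‖W p‖ ≤ 2 * ∑ a ∈ Tp p, g a ^ 2 := by
    intro p
    have h0 : 0 ≤ 2 * ∑ a ∈ Tp p, g a ^ 2 := by positivity
    refine le_of_sq_le_sq ?_ h0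
    rw [EuclideanSpace.norm_sq_eq]
    simp only [Real.norm_eq_abs, sq_abs, hW]
    rw [Finset.sum_coe_sort D (fun d => (∑ x ∈ Tp p ×ˢ Tp p,
      if x.1 - x.2 = d then g x.1 * g x.2 else 0) ^ 2)]
    rw [fiber_sq (Tp p ×ˢ Tp p) (fun x => x.1 - x.2) D (fun x hx => hDm x (by
      simp only [hTp, Finset.mem_filter, Finset.mem_product] at hx ⊢
      exact ⟨hx.1.1, hx.2.1⟩)) (fun x => g x.1 * g x.2)]
    have := e2_bound (Tp p) g (by
      intro a ha b hb
      simp only [hTp, Finset.mem_filter] at ha hb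
      refine le_trans (Finset.card_le_card ?_) (H2 a ha.1 b hb.1 (ha.2.trans hb.2.symm))
      intro y hy
      simp only [hTp, Finset.mem_filter, Finset.mem_product] at hy ⊢
      exact ⟨⟨hy.1.1.1, hy.1.2.1⟩, by rw [hy.1.1.2, ha.2], by rw [hy.1.2.2, ha.2], hy.2⟩)
    refine le_trans (le_of_eq ?_) (this.trans (le_of_eq (by ring)))
    simp only [Finset.sum_product]
    refine Finset.sum_congr rfl fun a _ => ?_
    conv_rhs => rw [Finset.sum_comm]
    refine Finset.sum_congr rfl fun c _ => ?_
    conv_rhs => rw [Finset.sum_comm]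
    refine Finset.sum_congr rfl fun d _ => Finset.sum_congr rfl fun b _ => ?_
    have : (a + b = c + d) ↔ (a - c = d - b) := by constructor <;> intro h <;> omega
    simp only [this]
    split_ifs <;> ring
  have hn : ‖(WithLp.toLp 2 V : EuclideanSpace ℝ D)‖ ≤ 2 * ∑ a ∈ T, g a ^ 2 := by
    rw [hVW]
    refine (norm_sum_le _ _).trans ((Finset.sum_le_sum fun p _ => hWn p).trans (le_of_eq ?_))
    rw [← Finset.mul_sum]
    congr 1
    exact Finset.sum_fiberwise_of_maps_to (fun a ha => Finset.mem_image_of_mem _ ha) _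
  have : I ≤ (2 * ∑ a ∈ T, g a ^ 2) ^ 2 := by
    rw [hIV]; exact pow_le_pow_left₀ (norm_nonneg _) hn 2
  nlinarith
theorem integral_fourier_eq (n : ℤ) :
    ∫ x : AddCircle (1 : ℝ), fourier n x ∂AddCircle.haarAddCircle = if n = 0 then (1 : ℂ) else 0 := by
  have h := congrFun (fourierCoeff_fourier (T := (1 : ℝ)) n) 0
  simp only [fourierCoeff, neg_zero, fourier_zero, one_smul] at h
  rw [h, Pi.single_apply]
  simp [eq_comm]

theorem integral_four (f : ℤ → ℂ) (T : Finset ℤ) :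
    ∫ x : AddCircle (1 : ℝ), ‖∑ ξ ∈ T, f ξ * fourier ξ x‖ ^ 4 ∂AddCircle.haarAddCircle
    ≤ ∑ a ∈ T, ∑ b ∈ T, ∑ c ∈ T, ∑ d ∈ T,
      (if a + b = c + d then ‖f a‖ * ‖f b‖ * (‖f c‖ * ‖f d‖) else 0) := by
  have pt : ∀ x : AddCircle (1 : ℝ), ((‖∑ ξ ∈ T, f ξ * fourier ξ x‖ ^ 4 : ℝ) : ℂ)
      = ∑ a ∈ T, ∑ b ∈ T, ∑ c ∈ T, ∑ d ∈ T,
        (f a * f b * (starRingEnd ℂ (f c) * starRingEnd ℂ (f d))) * fourier (a + b - c - d) x := by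
    intro x
    set F := ∑ ξ ∈ T, f ξ * fourier ξ x with hF
    have h1 : ((‖F‖ ^ 4 : ℝ) : ℂ) = F * (F * (starRingEnd ℂ F * starRingEnd ℂ F)) := by
      have := Complex.mul_conj' F
      push_cast
      calc (‖F‖ : ℂ) ^ 4 = ((‖F‖ : ℂ) ^ 2) ^ 2 := by ring
        _ = (F * starRingEnd ℂ F) ^ 2 := by rw [this]
        _ = _ := by ring
    rw [h1]
    have h2 : starRingEnd ℂ F = ∑ ξ ∈ T, starRingEnd ℂ (f ξ) * fourier (-ξ) x := by
      rw [hF, map_sum]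
      refine Finset.sum_congr rfl fun ξ _ => ?_
      rw [map_mul, fourier_neg]
    rw [h2, hF]
    have h3 : ∀ a b c d : ℤ, (f a * f b * (starRingEnd ℂ (f c) * starRingEnd ℂ (f d))) *
        fourier (a + b - c - d) x = (f a * fourier a x) * ((f b * fourier b x) *
        ((starRingEnd ℂ (f c) * fourier (-c) x) * (starRingEnd ℂ (f d) * fourier (-d) x))) := by
      intro a b c d
      rw [sub_eq_add_neg, sub_eq_add_neg, fourier_add, fourier_add, fourier_add]
      ring
    simp_rw [h3, ← Finset.mul_sum, ← Finset.sum_mul]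
  have hint : ((∫ x : AddCircle (1 : ℝ), ‖∑ ξ ∈ T, f ξ * fourier ξ x‖ ^ 4
      ∂AddCircle.haarAddCircle : ℝ) : ℂ) = ∑ a ∈ T, ∑ b ∈ T, ∑ c ∈ T, ∑ d ∈ T,
      (if a + b = c + d then f a * f b * (starRingEnd ℂ (f c) * starRingEnd ℂ (f d)) else 0) := by
    rw [← integral_complex_ofReal]
    simp only [pt]
    have hi : ∀ (z : ℂ) (n : ℤ), MeasureTheory.Integrable
        (fun x : AddCircle (1 : ℝ) => z * fourier n x) AddCircle.haarAddCircle := fun z n =>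
      (Continuous.integrable_of_hasCompactSupport (by fun_prop)
        (HasCompactSupport.of_compactSpace _))
    rw [MeasureTheory.integral_finsetSum]
    swap
    · exact fun a _ => MeasureTheory.integrable_finsetSum _ fun b _ =>
        MeasureTheory.integrable_finsetSum _ fun c _ =>
        MeasureTheory.integrable_finsetSum _ fun d _ => hi _ _
    refine Finset.sum_congr rfl fun a _ => ?_
    rw [MeasureTheory.integral_finsetSum]
    swap
    · exact fun b _ =>
        MeasureTheory.integrable_finsetSum _ fun c _ =>
        MeasureTheory.integrable_finsetSum _ fun d _ => hi _ _
    refine Finset.sum_congr rfl fun b _ => ?_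
    rw [MeasureTheory.integral_finsetSum]
    swap
    · exact fun c _ =>
        MeasureTheory.integrable_finsetSum _ fun d _ => hi _ _
    refine Finset.sum_congr rfl fun c _ => ?_
    rw [MeasureTheory.integral_finsetSum _ fun d _ => hi _ _]
    refine Finset.sum_congr rfl fun d _ => ?_
    rw [MeasureTheory.integral_const_mul, integral_fourier_eq]
    have : (a + b - c - d = 0) ↔ (a + b = c + d) := by constructor <;> intro h <;> omega
    simp [this]
  have hn := congrArg norm hint
  rw [Complex.norm_real] at hn
  refine (le_abs_self _).trans (hn.le.trans ?_)
  refine (norm_sum_le _ _).trans (Finset.sum_le_sum fun a _ => ?_)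
  refine (norm_sum_le _ _).trans (Finset.sum_le_sum fun b _ => ?_)
  refine (norm_sum_le _ _).trans (Finset.sum_le_sum fun c _ => ?_)
  refine (norm_sum_le _ _).trans (Finset.sum_le_sum fun d _ => ?_)
  split_ifs <;> simp

theorem lambda4_of_energy (S : Set ℤ)
    (h : ∀ (T : Finset ℤ) (g : ℤ → ℝ), (↑T : Set ℤ) ⊆ S → (∀ a, 0 ≤ g a) →
      ∑ a ∈ T, ∑ b ∈ T, ∑ c ∈ T, ∑ d ∈ T,
      (if a + b = c + d then g a * g b * (g c * g d) else 0) ≤ 8 * (∑ a ∈ T, g a ^ 2) ^ 2) :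
    SatisfiesLambda4 S 2 := by
  intro f hf
  set T := f.support
  have hm : MeasureTheory.MemLp (fun x : AddCircle (1 : ℝ) => ∑ ξ ∈ T, f ξ * fourier ξ x) 4
      AddCircle.haarAddCircle :=
    Continuous.memLp_of_hasCompactSupport (by fun_prop) (HasCompactSupport.of_compactSpace _)
  rw [hm.eLpNorm_eq_integral_rpow_norm (by norm_num) (by norm_num)]
  refine ENNReal.ofReal_le_ofReal ?_
  have h1 := (integral_four f T).trans (h T (fun a => ‖f a‖) hf (fun a => norm_nonneg _))
  have h4 : (4 : ENNReal).toReal = ((4 : ℕ) : ℝ) := by norm_num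
  rw [h4]
  simp only [Real.rpow_natCast]
  set I := ∫ x : AddCircle (1 : ℝ), ‖∑ ξ ∈ T, f ξ * fourier ξ x‖ ^ 4 ∂AddCircle.haarAddCircle
  have hI : 0 ≤ I := MeasureTheory.integral_nonneg fun x => by positivity
  set M := ∑ a ∈ T, ‖f a‖ ^ 2
  have hM : 0 ≤ M := Finset.sum_nonneg fun _ _ => by positivity
  have h2 : I ≤ (2 * Real.sqrt M) ^ 4 := by
    have : (2 * Real.sqrt M) ^ 4 = 16 * M ^ 2 := by
      rw [mul_pow, show Real.sqrt M ^ 4 = (Real.sqrt M ^ 2) ^ 2 by ring, Real.sq_sqrt hM]; norm_num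
    rw [this]; nlinarith [sq_nonneg M]
  calc I ^ (((4 : ℕ) : ℝ)⁻¹) ≤ ((2 * Real.sqrt M) ^ 4) ^ (((4 : ℕ) : ℝ)⁻¹) :=
        Real.rpow_le_rpow hI h2 (by norm_num)
    _ = 2 * Real.sqrt M := Real.pow_rpow_inv_natCast (by positivity) (by norm_num)

/-- Ordered pairs of distinct colours. -/
abbrev JJ (L : ℕ) : Type := {j : Fin L × Fin L // j.1 ≠ j.2}

/-- The countable set of generators. -/
abbrev Gn : Type := (Σ L : ℕ, Fin L) ⊕ ℕ ⊕ (Σ L : ℕ, (Fin L → Bool) × (JJ L → ℕ))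

/-- Restriction of `v` to the pairs that are separated by `l`. -/
def cut {L : ℕ} (l : Fin L → Bool) (v : JJ L → ℕ) : JJ L → ℕ :=
  fun j => if l j.1.1 ≠ l j.1.2 then v j else 0

/-- Sign of a boolean. -/
def sg (b : Bool) : ℤ := if b then 1 else -1

/-- The basic vectors, in the free abelian group on `Gn`. -/
noncomputable def vec (L : ℕ) (p : Fin L) (v : JJ L → ℕ) (i : ℕ) : Gn →₀ ℤ :=
  Finsupp.single (Sum.inl ⟨L, p⟩) 1 + Finsupp.single (Sum.inr (Sum.inl i)) 1 +
    ∑ l : Fin L → Bool, Finsupp.single (Sum.inr (Sum.inr ⟨L, l, cut l v⟩)) (sg (l p))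

open Classical in
theorem vec_tag (L : ℕ) (p : Fin L) (v : JJ L → ℕ) (i : ℕ) (k : Σ L : ℕ, Fin L) :
    vec L p v i (Sum.inl k) = if (⟨L, p⟩ : Σ L : ℕ, Fin L) = k then 1 else 0 := by
  simp [vec, Finsupp.single_apply, Finsupp.finsetSum_apply]

theorem vec_y (L : ℕ) (p : Fin L) (v : JJ L → ℕ) (i m : ℕ) :
    vec L p v i (Sum.inr (Sum.inl m)) = if i = m then 1 else 0 := by
  classical
  simp [vec, Finsupp.single_apply, Finsupp.finsetSum_apply]

open Classical in
theorem vec_z (L : ℕ) (p : Fin L) (v : JJ L → ℕ) (i : ℕ) (l : Fin L → Bool) (r : JJ L → ℕ) :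
    vec L p v i (Sum.inr (Sum.inr ⟨L, l, r⟩)) = if cut l v = r then sg (l p) else 0 := by
  simp only [vec, Finsupp.add_apply, Finsupp.finsetSum_apply, Finsupp.single_apply]
  rw [Finset.sum_eq_single l]
  · simp
  · intro b _ hb
    simp [hb]
  · simp

theorem vec_z_ne (L : ℕ) (p : Fin L) (v : JJ L → ℕ) (i : ℕ) (L' : ℕ) (h : L ≠ L')
    (x : (Fin L' → Bool) × (JJ L' → ℕ)) :
    vec L p v i (Sum.inr (Sum.inr ⟨L', x⟩)) = 0 := by
  classical
  simp [vec, Finsupp.single_apply, Finsupp.finsetSum_apply, h]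

theorem vec_abs (L : ℕ) (p : Fin L) (v : JJ L → ℕ) (i : ℕ) (x : Gn) : |vec L p v i x| ≤ 1 := by
  classical
  rcases x with k | m | ⟨L', l, r⟩
  · rw [vec_tag]; split_ifs <;> simp
  · rw [vec_y]; split_ifs <;> simp
  · by_cases h : L = L'
    · subst h
      rw [vec_z]
      unfold sg
      split_ifs <;> simp
    · rw [vec_z_ne _ _ _ _ _ h]; simp

theorem sep_exists {L : ℕ} (j j' : JJ L) :
    ∃ l : Fin L → Bool, l j.1.1 ≠ l j.1.2 ∧ l j'.1.1 ≠ l j'.1.2 := by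
  obtain ⟨⟨a, b⟩, hab⟩ := j
  obtain ⟨⟨c, d⟩, hcd⟩ := j'
  simp only [ne_eq] at hab hcd ⊢
  by_cases h1 : c = a
  · exact ⟨fun x => decide (x = a), by grind⟩
  by_cases h2 : d = a
  · exact ⟨fun x => decide (x = a), by grind⟩
  by_cases h3 : b = c
  · exact ⟨fun x => decide (x = a ∨ x = d), by grind⟩
  · exact ⟨fun x => decide (x = a ∨ x = c), by grind⟩

theorem cut_sidon {L : ℕ} (v1 v2 v3 : JJ L → ℕ)
    (h : ∀ l, cut l v3 = cut l v1 ∨ cut l v3 = cut l v2) : v3 = v1 ∨ v3 = v2 := by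
  by_contra hc
  push Not at hc
  obtain ⟨j, hj⟩ := Function.ne_iff.1 hc.1
  obtain ⟨j', hj'⟩ := Function.ne_iff.1 hc.2
  obtain ⟨l, hl, hl'⟩ := sep_exists j j'
  rcases h l with h | h
  · have := congrFun h j
    simp only [cut, if_pos hl] at this
    exact hj this
  · have := congrFun h j'
    simp only [cut, if_pos hl'] at this
    exact hj' this

theorem base_inj (e : Gn → ℕ) (he : Function.Injective e) (c : Gn →₀ ℤ) (hc : ∀ x, |c x| ≤ 4)
    (h : Finsupp.linearCombination ℤ (fun x => (10 : ℤ) ^ e x) c = 0) : c = 0 := by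
  classical
  by_contra hne
  have hs : c.support.Nonempty := Finsupp.support_nonempty_iff.2 hne
  obtain ⟨x, hx, hmin⟩ := Finset.exists_min_image c.support e hs
  rw [Finsupp.linearCombination_apply, Finsupp.sum, ← Finset.add_sum_erase _ _ hx] at h
  have hd : (10 : ℤ) ^ (e x + 1) ∣ ∑ y ∈ c.support.erase x, c y • (10 : ℤ) ^ e y := by
    refine Finset.dvd_sum fun y hy => ?_
    rw [Finset.mem_erase] at hy
    have h1 := hmin y hy.2
    have h2 : e y ≠ e x := fun h => hy.1 (he h)
    rw [smul_eq_mul]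
    exact Dvd.dvd.mul_left (pow_dvd_pow _ (by omega)) _
  have hd2 : (10 : ℤ) ^ (e x + 1) ∣ c x * 10 ^ e x := by
    have : c x * 10 ^ e x = - ∑ y ∈ c.support.erase x, c y • (10 : ℤ) ^ e y := by
      rw [smul_eq_mul] at h; linarith
    rw [this]; exact (dvd_neg).2 hd
  rw [pow_succ, mul_comm] at hd2
  have hd3 : (10 : ℤ) ∣ c x := Int.dvd_of_mul_dvd_mul_right (by positivity) hd2
  have h4 := abs_le.1 (hc x)
  have h0 : c x ≠ 0 := Finsupp.mem_support_iff.1 hx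
  omega

/-- The chosen encoding of generators. -/
noncomputable def enc : Gn → ℕ := (exists_injective_nat Gn).choose

theorem enc_inj : Function.Injective enc := (exists_injective_nat Gn).choose_spec

/-- The integer attached to `(L, p, v, i)`. -/
noncomputable def elt (L : ℕ) (p : Fin L) (v : JJ L → ℕ) (i : ℕ) : ℤ :=
  Finsupp.linearCombination ℤ (fun x => (10 : ℤ) ^ enc x) (vec L p v i)

theorem elt_sum_vec {L1 L2 L3 L4 : ℕ} {p1 : Fin L1} {p2 : Fin L2} {p3 : Fin L3} {p4 : Fin L4}
    {v1 : JJ L1 → ℕ} {v2 : JJ L2 → ℕ} {v3 : JJ L3 → ℕ} {v4 : JJ L4 → ℕ} {i1 i2 i3 i4 : ℕ}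
    (h : elt L1 p1 v1 i1 + elt L2 p2 v2 i2 = elt L3 p3 v3 i3 + elt L4 p4 v4 i4) :
    vec L1 p1 v1 i1 + vec L2 p2 v2 i2 = vec L3 p3 v3 i3 + vec L4 p4 v4 i4 := by
  rw [← sub_eq_zero]
  refine base_inj enc enc_inj _ ?_ ?_
  · intro x
    have h1 := abs_le.1 (vec_abs L1 p1 v1 i1 x)
    have h2 := abs_le.1 (vec_abs L2 p2 v2 i2 x)
    have h3 := abs_le.1 (vec_abs L3 p3 v3 i3 x)
    have h4 := abs_le.1 (vec_abs L4 p4 v4 i4 x)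
    simp only [Finsupp.sub_apply, Finsupp.add_apply]
    rw [abs_le]
    constructor <;> linarith
  · simp only [map_sub, map_add]
    simp only [elt] at h
    rw [h, sub_self]

theorem elt_sum_tag {L1 L2 L3 L4 : ℕ} {p1 : Fin L1} {p2 : Fin L2} {p3 : Fin L3} {p4 : Fin L4}
    {v1 : JJ L1 → ℕ} {v2 : JJ L2 → ℕ} {v3 : JJ L3 → ℕ} {v4 : JJ L4 → ℕ} {i1 i2 i3 i4 : ℕ}
    (h : elt L1 p1 v1 i1 + elt L2 p2 v2 i2 = elt L3 p3 v3 i3 + elt L4 p4 v4 i4) :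
    ((⟨L1, p1⟩ : Σ L : ℕ, Fin L) = ⟨L3, p3⟩ ∧ (⟨L2, p2⟩ : Σ L : ℕ, Fin L) = ⟨L4, p4⟩) ∨
    ((⟨L1, p1⟩ : Σ L : ℕ, Fin L) = ⟨L4, p4⟩ ∧ (⟨L2, p2⟩ : Σ L : ℕ, Fin L) = ⟨L3, p3⟩) := by
  classical
  have hv := elt_sum_vec h
  have ht : ∀ k : Σ L : ℕ, Fin L, (if (⟨L1, p1⟩ : Σ L : ℕ, Fin L) = k then (1 : ℤ) else 0) +
      (if (⟨L2, p2⟩ : Σ L : ℕ, Fin L) = k then 1 else 0) =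
      (if (⟨L3, p3⟩ : Σ L : ℕ, Fin L) = k then 1 else 0) +
      (if (⟨L4, p4⟩ : Σ L : ℕ, Fin L) = k then 1 else 0) := by
    intro k
    have := DFunLike.congr_fun hv (Sum.inl k)
    simpa only [Finsupp.add_apply, vec_tag] using this
  generalize (⟨L1, p1⟩ : Σ L : ℕ, Fin L) = k1 at *
  generalize (⟨L2, p2⟩ : Σ L : ℕ, Fin L) = k2 at *
  generalize (⟨L3, p3⟩ : Σ L : ℕ, Fin L) = k3 at *
  generalize (⟨L4, p4⟩ : Σ L : ℕ, Fin L) = k4 at *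
  have a1 := ht k1
  have a2 := ht k2
  have a3 := ht k3
  have a4 := ht k4
  clear ht hv h
  grind

theorem elt_sum_same {L : ℕ} {p : Fin L}
    {v1 v2 v3 v4 : JJ L → ℕ} {i1 i2 i3 i4 : ℕ}
    (h : elt L p v1 i1 + elt L p v2 i2 = elt L p v3 i3 + elt L p v4 i4) :
    (v3 = v1 ∨ v3 = v2) ∧ (i3 = i1 ∨ i3 = i2) := by
  classical
  have hv := elt_sum_vec h
  constructor
  · refine cut_sidon _ _ _ fun l => ?_
    have := DFunLike.congr_fun hv (Sum.inr (Sum.inr ⟨L, l, cut l v3⟩))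
    simp only [Finsupp.add_apply, vec_z, if_true] at this
    by_contra hc
    push Not at hc
    rw [if_neg (Ne.symm hc.1), if_neg (Ne.symm hc.2)] at this
    revert this
    unfold sg
    split_ifs <;> simp
  · have := DFunLike.congr_fun hv (Sum.inr (Sum.inl i3))
    simp only [Finsupp.add_apply, vec_y, if_true] at this
    by_contra hc
    push Not at hc
    rw [if_neg (Ne.symm hc.1), if_neg (Ne.symm hc.2)] at this
    split_ifs at this <;> simp at this

theorem elt_inj {L L' : ℕ} {p : Fin L} {p' : Fin L'} {v : JJ L → ℕ} {v' : JJ L' → ℕ} {i i' : ℕ}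
    (h : elt L p v i = elt L' p' v' i') :
    (⟨L, p⟩ : Σ L : ℕ, Fin L) = ⟨L', p'⟩ ∧ HEq v v' ∧ i = i' := by
  have h2 : elt L p v i + elt L p v i = elt L' p' v' i' + elt L' p' v' i' := by rw [h]
  have h3 : (⟨L, p⟩ : Σ L : ℕ, Fin L) = ⟨L', p'⟩ := by
    rcases elt_sum_tag h2 with h | h <;> exact h.1
  refine ⟨h3, ?_⟩
  cases h3
  have := elt_sum_same h2
  simp only [or_self] at this
  exact ⟨heq_of_eq this.1.symm, this.2.symm⟩

/-- Sum along the diagonal only depends on the coordinates other than `(p, q)`. -/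
theorem elt_add_congr {L : ℕ} (p q : Fin L) (hpq : p ≠ q) (v w : JJ L → ℕ) (i : ℕ)
    (h : ∀ j : JJ L, j ≠ ⟨(p, q), hpq⟩ → v j = w j) :
    elt L p v i + elt L q v i = elt L p w i + elt L q w i := by
  simp only [elt, ← map_add]
  congr 1
  have key : ∀ l : Fin L → Bool,
      (Finsupp.single (Sum.inr (Sum.inr ⟨L, l, cut l v⟩)) (sg (l p)) : Gn →₀ ℤ) +
      Finsupp.single (Sum.inr (Sum.inr ⟨L, l, cut l v⟩)) (sg (l q)) =
      Finsupp.single (Sum.inr (Sum.inr ⟨L, l, cut l w⟩)) (sg (l p)) +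
      Finsupp.single (Sum.inr (Sum.inr ⟨L, l, cut l w⟩)) (sg (l q)) := by
    intro l
    rw [← Finsupp.single_add, ← Finsupp.single_add]
    by_cases hl : l p = l q
    · have : cut l v = cut l w := by
        funext j
        unfold cut
        split_ifs with hj
        · refine h j ?_
          rintro rfl
          exact hj hl
        · rfl
      rw [this]
    · have : sg (l p) + sg (l q) = 0 := by
        unfold sg
        cases h1 : l p <;> cases h2 : l q <;> simp_all
      rw [this]; simp
  have key2 := Finset.sum_congr (rfl : (Finset.univ : Finset (Fin L → Bool)) = Finset.univ)
    (fun l _ => key l)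
  rw [Finset.sum_add_distrib, Finset.sum_add_distrib] at key2
  simp only [vec]
  rw [add_add_add_comm, key2, ← add_add_add_comm]

theorem elt_sub_congr {L : ℕ} (p q : Fin L) (v : JJ L → ℕ) (i i' : ℕ) :
    elt L p v i - elt L q v i = elt L p v i' - elt L q v i' := by
  simp only [elt, ← map_sub]
  congr 1
  simp only [vec]
  abel

/-- The big set. -/
def bigS : Set ℤ := {n | ∃ L p v i, n = elt L p v i}

open Classical in
theorem bigS_energy (T : Finset ℤ) (g : ℤ → ℝ) (hT : (↑T : Set ℤ) ⊆ bigS) (hg : ∀ a, 0 ≤ g a) :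
    ∑ a ∈ T, ∑ b ∈ T, ∑ c ∈ T, ∑ d ∈ T,
      (if a + b = c + d then g a * g b * (g c * g d) else 0) ≤ 8 * (∑ a ∈ T, g a ^ 2) ^ 2 := by
  have hcol : ∃ col : ℤ → Σ L : ℕ, Fin L, ∀ L p v i, col (elt L p v i) = ⟨L, p⟩ := by
    refine ⟨fun n => if h : ∃ k : (Σ L : ℕ, Fin L), ∃ v i, n = elt k.1 k.2 v i then h.choose
      else ⟨1, 0⟩, ?_⟩
    intro L p v i
    have h : ∃ k : (Σ L : ℕ, Fin L), ∃ v' i', elt L p v i = elt k.1 k.2 v' i' :=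
      ⟨⟨L, p⟩, v, i, rfl⟩
    simp only [dif_pos h]
    obtain ⟨v', i', h'⟩ := h.choose_spec
    exact (elt_inj h').1.symm
  obtain ⟨col, hcol⟩ := hcol
  refine energy_bound T col g hg ?_ ?_
  · intro a ha b hb c hc d hd h
    obtain ⟨L1, p1, v1, i1, rfl⟩ := hT ha
    obtain ⟨L2, p2, v2, i2, rfl⟩ := hT hb
    obtain ⟨L3, p3, v3, i3, rfl⟩ := hT hc
    obtain ⟨L4, p4, v4, i4, rfl⟩ := hT hd
    simp only [hcol]
    exact elt_sum_tag h
  · intro a ha b hb hab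
    obtain ⟨L, p, v1, i1, rfl⟩ := hT ha
    obtain ⟨L2, p2, v2, i2, rfl⟩ := hT hb
    rw [hcol, hcol] at hab
    cases hab
    set s := elt L p v1 i1 + elt L p v2 i2 with hs
    set F : Finset ℤ := {elt L p v1 i1, elt L p v1 i2, elt L p v2 i1, elt L p v2 i2} with hF
    have hF4 : F.card ≤ 4 := Finset.card_le_four
    refine le_trans (Finset.card_le_card_of_injOn (t := F) (fun y => y.1) ?_ ?_) hF4
    · intro y hy
      simp only [Finset.coe_filter, Finset.mem_product, Set.mem_ofPred_eq, hcol] at hy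
      obtain ⟨⟨h1, h2⟩, h3, h4, h5⟩ := hy
      obtain ⟨c, d⟩ := y
      obtain ⟨L3, p3, v3, i3, rfl⟩ := hT h1
      obtain ⟨L4, p4, v4, i4, rfl⟩ := hT h2
      simp only [hcol] at h3 h4
      cases h3
      cases h4
      obtain ⟨hv, hi⟩ := elt_sum_same (hs.symm.trans h5)
      rcases hv with rfl | rfl <;> rcases hi with rfl | rfl <;> simp [hF]
    · intro y hy z hz hyz
      simp only [Finset.coe_filter, Set.mem_ofPred_eq] at hy hz
      ext
      · exact hyz
      · have := hy.2.2.2.symm.trans hz.2.2.2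
        simp only at hyz
        omega

theorem fib_count {Ω : Type} [Fintype Ω] [DecidableEq Ω] {n g : ℕ} (U : Finset Ω)
    (upd : Ω → Fin n → Ω) (val : Ω → Fin n) (hval : ∀ u t, val (upd u t) = t)
    (h : ∀ ω t, (U.filter (fun u => upd u t = ω)).card ≤ g) :
    U.card * n ≤ g * Fintype.card Ω := by
  have h1 := Finset.card_le_mul_card_image_of_maps_to
    (f := fun x : Ω × Fin n => upd x.1 x.2) (s := U ×ˢ (Finset.univ : Finset (Fin n)))
    (t := (Finset.univ : Finset Ω)) (fun _ _ => Finset.mem_univ _) g (by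
      intro ω _
      refine le_trans (Finset.card_le_card_of_injOn (fun x => x.1) ?_ ?_) (h ω (val ω))
      · intro x hx
        simp only [Finset.coe_filter, Finset.mem_product, Finset.mem_univ, and_true,
          Set.mem_ofPred_eq] at hx ⊢
        refine ⟨hx.1, ?_⟩
        have : val ω = x.2 := by rw [← hx.2, hval]
        rw [this]; exact hx.2
      · intro x hx y hy hxy
        simp only [Finset.coe_filter, Finset.mem_product, Finset.mem_univ, and_true,
          Set.mem_ofPred_eq] at hx hy
        ext1
        · exact hxy
        · rw [← hval x.1 x.2, hx.2, ← hy.2, hval])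
  simpa [Finset.card_product] using h1

theorem pair_count {Ω : Type} [Fintype Ω] [DecidableEq Ω] {L n g : ℕ}
    (B : Finset (Fin L × Ω)) (hΩ : 0 < Fintype.card Ω) (hn : L * L * g < n)
    (h : ∀ p q : Fin L, p ≠ q →
      (Finset.univ.filter (fun ω : Ω => (p, ω) ∈ B ∧ (q, ω) ∈ B)).card * n
        ≤ g * Fintype.card Ω) :
    B.card < 2 * Fintype.card Ω := by
  set C : Ω → Finset (Fin L) := fun ω => Finset.univ.filter (fun p => (p, ω) ∈ B) with hC
  have h1 : B.card = ∑ ω : Ω, (C ω).card := by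
    rw [Finset.card_eq_sum_card_fiberwise (f := fun x => x.2) (t := Finset.univ)
      (fun _ _ => Finset.mem_coe.2 (Finset.mem_univ _))]
    refine Finset.sum_congr rfl fun ω _ => ?_
    refine Finset.card_bij' (fun x _ => x.1) (fun p _ => (p, ω)) ?_ ?_ ?_ ?_
    · rintro ⟨p, w⟩ hx
      simp only [Finset.mem_filter] at hx
      simp only [hC, Finset.mem_filter, Finset.mem_univ, true_and]
      rw [← hx.2]; exact hx.1
    · intro p hp
      simpa [hC] using hp
    · rintro ⟨p, w⟩ hx
      simp only [Finset.mem_filter] at hx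
      simp [hx.2]
    · simp
  have h2 : ∀ ω, (C ω).card ≤ 1 + (C ω).offDiag.card := by
    intro ω
    rw [Finset.offDiag_card]
    generalize (C ω).card = c
    rcases c with _ | c
    · simp
    · have : (c + 1) * (c + 1) - (c + 1) = (c + 1) * c := by
        rw [Nat.sub_eq_iff_eq_add (by nlinarith)]; ring
      rw [this]; nlinarith
  have h3 : ∑ ω : Ω, (C ω).offDiag.card =
      ∑ x ∈ (Finset.univ : Finset (Fin L)).offDiag,
        (Finset.univ.filter (fun ω : Ω => (x.1, ω) ∈ B ∧ (x.2, ω) ∈ B)).card := by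
    simp only [Finset.card_filter]
    rw [Finset.sum_comm]
    refine Finset.sum_congr rfl fun ω _ => ?_
    rw [← Finset.card_filter]
    congr 1
    ext x
    simp only [hC, Finset.mem_offDiag, Finset.mem_filter, Finset.mem_univ, true_and]
    tauto
  have h4 : (∑ ω : Ω, (C ω).offDiag.card) * n ≤ (L * L) * (g * Fintype.card Ω) := by
    rw [h3, Finset.sum_mul]
    refine (Finset.sum_le_card_nsmul _ _ (g * Fintype.card Ω) ?_).trans ?_
    · intro x hx
      exact h x.1 x.2 (Finset.mem_offDiag.1 hx).2.2
    · rw [smul_eq_mul]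
      refine Nat.mul_le_mul_right _ ?_
      rw [Finset.offDiag_card]
      simp
  have h5 : B.card ≤ Fintype.card Ω + ∑ ω : Ω, (C ω).offDiag.card := by
    rw [h1]
    refine (Finset.sum_le_sum fun ω _ => h2 ω).trans ?_
    rw [Finset.sum_add_distrib]
    simp
  by_contra hcon
  push Not at hcon
  have h6 : Fintype.card Ω ≤ ∑ ω : Ω, (C ω).offDiag.card := by omega
  have h7 := Nat.mul_le_mul_right n h6
  have h8 : (L * L * g) * Fintype.card Ω < n * Fintype.card Ω := Nat.mul_lt_mul_of_pos_right hn hΩ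
  nlinarith

/-- Box parametrisation. -/
noncomputable def box (L n : ℕ) (x : Fin L × ((JJ L → Fin n) × Fin n)) : ℤ :=
  elt L x.1 (fun j => (x.2.1 j : ℕ)) x.2.2

theorem box_inj (L n : ℕ) : Function.Injective (box L n) := by
  rintro ⟨p, v, i⟩ ⟨q, w, k⟩ h
  obtain ⟨h1, h2, h3⟩ := elt_inj h
  simp only [Sigma.mk.injEq, heq_eq_eq, true_and] at h1
  have h2 := eq_of_heq h2
  have h4 : v = w := by
    funext j
    exact Fin.ext (congrFun h2 j)
  have h5 : i = k := Fin.ext h3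
  rw [h1, h4, h5]

theorem line_sum {L n g : ℕ} {A' : Set ℤ} (hA : IsB2 g A') {p q : Fin L} (hpq : p ≠ q)
    (F : Finset ((JJ L → Fin n) × Fin n))
    (h1 : ∀ u ∈ F, box L n (p, u) ∈ A' ∧ box L n (q, u) ∈ A') (ξ : ℤ)
    (h2 : ∀ u ∈ F, box L n (p, u) + box L n (q, u) = ξ) : F.card ≤ g := by
  have h3 := hA ξ
  set φ : ((JJ L → Fin n) × Fin n) → Sym2 ℤ := fun u => s(box L n (p, u), box L n (q, u)) with hφ
  have hinj : Function.Injective φ := by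
    intro u w huw
    simp only [hφ, Sym2.eq_iff] at huw
    rcases huw with h | h
    · have := box_inj L n h.1
      simpa using this
    · have := box_inj L n h.1
      simp only [Prod.mk.injEq] at this
      exact absurd this.1 hpq
  have h4 : (φ '' (F : Set _)).encard = F.card := by
    rw [hinj.encard_image, Set.encard_coe_eq_coe_finsetCard]
  have h5 : (φ '' (F : Set _)) ⊆ {p : Sym2 ℤ | ∃ a ∈ A', ∃ b ∈ A', p = s(a, b) ∧ a + b = ξ} := by
    rintro _ ⟨u, hu, rfl⟩
    exact ⟨_, (h1 u hu).1, _, (h1 u hu).2, rfl, h2 u hu⟩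
  have h6 := (Set.encard_le_encard h5).trans h3
  rw [h4] at h6
  exact_mod_cast h6

theorem line_diff {L n g : ℕ} {A' : Set ℤ} (hA : IsB2Circ g A') {p q : Fin L} (hpq : p ≠ q)
    (F : Finset ((JJ L → Fin n) × Fin n))
    (h1 : ∀ u ∈ F, box L n (p, u) ∈ A' ∧ box L n (q, u) ∈ A') (ξ : ℤ)
    (h2 : ∀ u ∈ F, box L n (p, u) - box L n (q, u) = ξ) : F.card ≤ g := by
  rcases F.eq_empty_or_nonempty with rfl | ⟨u0, hu0⟩
  · simp
  have hξ : ξ ≠ 0 := by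
    rw [← h2 u0 hu0]
    intro h
    have := box_inj L n (sub_eq_zero.1 h)
    simp only [Prod.mk.injEq] at this
    exact hpq this.1
  have h3 := hA ξ hξ
  set φ : ((JJ L → Fin n) × Fin n) → ℤ × ℤ := fun u => (box L n (p, u), box L n (q, u)) with hφ
  have hinj : Function.Injective φ := by
    intro u w huw
    simp only [hφ, Prod.mk.injEq] at huw
    have := box_inj L n huw.1
    simpa using this
  have h4 : (φ '' (F : Set _)).encard = F.card := by
    rw [hinj.encard_image, Set.encard_coe_eq_coe_finsetCard]
  have h5 : (φ '' (F : Set _)) ⊆ {p : ℤ × ℤ | p.1 ∈ A' ∧ p.2 ∈ A' ∧ p.1 - p.2 = ξ} := by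
    rintro _ ⟨u, hu, rfl⟩
    exact ⟨(h1 u hu).1, (h1 u hu).2, h2 u hu⟩
  have h6 := (Set.encard_le_encard h5).trans h3
  rw [h4] at h6
  exact_mod_cast h6

theorem stmt_18 :
    ∃ S : Set ℤ, ∃ K : ℝ, 0 < K ∧ SatisfiesLambda4 S K ∧
      ∀ δ : ℝ, 0 < δ → ∀ g : ℕ, 0 < g →
        ∃ A : Set ℤ, A ⊆ S ∧ A.Finite ∧ A.Nonempty ∧
          ∀ A' ⊆ A, δ * (A.ncard : ℝ) ≤ (A'.ncard : ℝ) →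
            ¬ IsB2 g A' ∧ ¬ IsB2Circ g A' := by
  classical
  refine ⟨bigS, 2, by norm_num, lambda4_of_energy bigS (fun T g' hT hg' => ?_), ?_⟩
  · have := bigS_energy T g' hT hg'
    convert this
  intro δ hδ g _
  obtain ⟨L0, hL0⟩ := exists_nat_gt (2 / δ)
  set L := L0 + 1 with hL
  have hδL : 2 ≤ δ * L := by
    rw [div_lt_iff₀ hδ] at hL0
    rw [hL]; push_cast; nlinarith
  set n := L * L * g + 1 with hn
  have hnpos : 0 < n := by omega
  haveI : NeZero n := ⟨by omega⟩
  haveI : NeZero L := ⟨by omega⟩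
  have hΩ : 0 < Fintype.card ((JJ L → Fin n) × Fin n) := Fintype.card_pos
  refine ⟨Set.range (box L n), ?_, Set.finite_range _, Set.range_nonempty _, ?_⟩
  · rintro _ ⟨x, rfl⟩
    exact ⟨L, _, _, _, rfl⟩
  intro A' hA' hcard
  set B : Finset (Fin L × ((JJ L → Fin n) × Fin n)) :=
    Finset.univ.filter (fun x => box L n x ∈ A') with hB
  have hBm : ∀ x, x ∈ B ↔ box L n x ∈ A' := by intro x; simp [hB]
  have hAB : A' = box L n '' (B : Set _) := by
    ext a
    constructor
    · intro ha
      obtain ⟨x, rfl⟩ := hA' ha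
      exact ⟨x, by simpa [hB] using ha, rfl⟩
    · rintro ⟨x, hx, rfl⟩
      exact (hBm x).1 hx
  have hA'c : A'.ncard = B.card := by
    rw [hAB, Set.ncard_image_of_injective _ (box_inj L n), Set.ncard_coe_finset]
  have hAc : (Set.range (box L n)).ncard = L * Fintype.card ((JJ L → Fin n) × Fin n) := by
    rw [← Set.image_univ, Set.ncard_image_of_injective _ (box_inj L n), Set.ncard_univ,
      Nat.card_eq_fintype_card, Fintype.card_prod, Fintype.card_fin]
  have hBc : 2 * Fintype.card ((JJ L → Fin n) × Fin n) ≤ B.card := by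
    rw [hAc, hA'c] at hcard
    have h0 : (0 : ℝ) ≤ Fintype.card ((JJ L → Fin n) × Fin n) := Nat.cast_nonneg _
    have : (2 * Fintype.card ((JJ L → Fin n) × Fin n) : ℝ) ≤ B.card := by
      refine le_trans ?_ hcard
      rw [Nat.cast_mul, ← mul_assoc]
      exact mul_le_mul_of_nonneg_right hδL h0
    exact_mod_cast this
  constructor
  · intro h2
    refine absurd (pair_count (n := n) (g := g) B hΩ (by omega) ?_) (not_lt.2 hBc)
    intro p q hpq
    refine fib_count _ (fun u t => (Function.update u.1 ⟨(p, q), hpq⟩ t, u.2))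
      (fun u => u.1 ⟨(p, q), hpq⟩) (by intro u t; simp) ?_
    intro ω t
    refine line_sum h2 hpq _ ?_ (box L n (p, ω) + box L n (q, ω)) ?_
    · intro u hu
      simp only [Finset.mem_filter, Finset.mem_univ, true_and] at hu
      exact ⟨(hBm _).1 hu.1.1, (hBm _).1 hu.1.2⟩
    · intro u hu
      simp only [Finset.mem_filter, Finset.mem_univ, true_and] at hu
      rw [← hu.2]
      refine elt_add_congr p q hpq _ _ _ ?_
      intro j hj
      simp [Function.update_of_ne hj]
  · intro h2
    refine absurd (pair_count (n := n) (g := g) B hΩ (by omega) ?_) (not_lt.2 hBc)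
    intro p q hpq
    refine fib_count _ (fun u t => (u.1, t)) (fun u => u.2) (by intro u t; simp) ?_
    intro ω t
    refine line_diff h2 hpq _ ?_ (box L n (p, ω) - box L n (q, ω)) ?_
    · intro u hu
      simp only [Finset.mem_filter, Finset.mem_univ, true_and] at hu
      exact ⟨(hBm _).1 hu.1.1, (hBm _).1 hu.1.2⟩
    · intro u hu
      simp only [Finset.mem_filter, Finset.mem_univ, true_and] at hu
      rw [← hu.2]
      exact elt_sub_congr p q _ _ _
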